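/- Fix an integer ℓ ≥ 2 and a vector 𝐦 = (𝐦_S) of nonnegative integers indexed by unordered pairs of distinct elements of [ℓ], not all zero, and set σ = Σ_S 𝐦_S and P(n) = 2^n · Π_S (1/𝐦_S!)·(𝐦_S·n/σ)^{𝐦_S} (with the convention 0^0 = 1). Then there exists a constant C > 0 such that for every integer n ≥ 1, (1 − C/n)·P(n) ≤ s*(n,ℓ,𝐦) ≤ (1 + C/n)·P(n). -/

import Mathlib

open scoped Classical

noncomputable section

/-- The `𝐦`-overlapping property: for distinct `k1, k2` and `A ∈ 𝓕_{k1}`, `B ∈ 𝓕_{k2}`,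
`|A ∩ B| ≤ 𝐦_{k1,k2}`. -/
def Overlap {n ℓ : ℕ} (m : Fin ℓ → Fin ℓ → ℕ) (F : Fin ℓ → Finset (Finset (Fin n))) : Prop :=
  ∀ k1 k2 : Fin ℓ, k1 ≠ k2 → ∀ A ∈ F k1, ∀ B ∈ F k2, (A ∩ B).card ≤ m k1 k2

/-- `s*(n, ℓ, 𝐦)`: the maximum of `|𝓕_1|⋯|𝓕_ℓ|` over `𝐦`-overlapping tuples. -/
def sStar (n ℓ : ℕ) (m : Fin ℓ → Fin ℓ → ℕ) : ℕ :=
  sSup {P : ℕ | ∃ F : Fin ℓ → Finset (Finset (Fin n)), Overlap m F ∧ P = ∏ k, (F k).card}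

/-- The set of (representatives of) unordered pairs of distinct elements of `[ℓ]`. -/
def pairs (ℓ : ℕ) : Finset (Fin ℓ × Fin ℓ) :=
  (Finset.univ : Finset (Fin ℓ × Fin ℓ)).filter (fun p => p.1 < p.2)

open scoped FinsetFamily in
/-- Iterating the four functions inequality over the members of a tuple of down-sets. -/
lemma exists_join_prod_card_le {α : Type*} [DecidableEq α] {ℓ : ℕ}
    (F : Fin ℓ → Finset (Finset α)) (hdown : ∀ k, ∀ A ∈ F k, ∀ B, B ⊆ A → B ∈ F k)
    (I : Finset (Fin ℓ)) :
    ∃ J : Finset (Finset α),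
      (∀ A ∈ J, ∃ B : Fin ℓ → Finset α, (∀ i ∈ I, B i ∈ F i) ∧ A = I.biUnion B) ∧
      ∏ i ∈ I, (F i).card ≤
        J.card * ∏ k ∈ I, ∏ i ∈ I.filter (· < k), (F i ∩ F k).card := by
  induction I using Finset.induction_on_max with
  | empty => exact ⟨{∅}, by simp, by simp⟩
  | insert a I ha ih =>
    obtain ⟨J, hJ, hle⟩ := ih
    have haI : a ∉ I := fun h => lt_irrefl a (ha a h)
    refine ⟨J ⊻ F a, ?_, ?_⟩
    · intro A hA
      obtain ⟨X, hX, Y, hY, rfl⟩ := Finset.mem_sups.1 hA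
      obtain ⟨B, hB, rfl⟩ := hJ X hX
      refine ⟨Function.update B a Y, ?_, ?_⟩
      · intro i hi
        rcases Finset.mem_insert.1 hi with rfl | hi
        · simpa using hY
        · rw [Function.update_of_ne (ha i hi).ne]
          exact hB i hi
      · rw [Finset.biUnion_insert, Function.update_self, Finset.union_comm, Finset.sup_eq_union]
        congr 1
        refine Finset.biUnion_congr rfl fun i hi => ?_
        rw [Function.update_of_ne (ha i hi).ne]
    · have hmeet : (J ⊼ F a).card ≤ ∏ i ∈ I, (F i ∩ F a).card := by
        let T : Fin ℓ → Finset (Finset α) := fun i => if i ∈ I then F i ∩ F a else {∅}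
        have hsub : J ⊼ F a ⊆ (Fintype.piFinset T).image (fun B => I.biUnion B) := by
          intro A hA
          obtain ⟨X, hX, Y, hY, rfl⟩ := Finset.mem_infs.1 hA
          obtain ⟨B, hB, rfl⟩ := hJ X hX
          refine Finset.mem_image.2 ⟨fun i => if i ∈ I then B i ∩ Y else ∅, ?_, ?_⟩
          · refine Fintype.mem_piFinset.2 fun i => ?_
            by_cases hi : i ∈ I
            · simp only [T, hi, if_true, Finset.mem_inter]
              exact ⟨hdown i _ (hB i hi) _ Finset.inter_subset_left,
                hdown a _ hY _ Finset.inter_subset_right⟩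
            · simp [T, hi]
          · ext x
            simp only [Finset.mem_biUnion, Finset.inf_eq_inter, Finset.mem_inter]
            constructor
            · rintro ⟨i, hi, hx⟩
              rw [if_pos hi, Finset.mem_inter] at hx
              exact ⟨⟨i, hi, hx.1⟩, hx.2⟩
            · rintro ⟨⟨i, hi, hx⟩, hy⟩
              exact ⟨i, hi, by rw [if_pos hi]; exact Finset.mem_inter.2 ⟨hx, hy⟩⟩
        refine (Finset.card_le_card hsub).trans (Finset.card_image_le.trans ?_)
        rw [Fintype.card_piFinset, ← Finset.prod_subset (Finset.subset_univ I)]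
        · exact le_of_eq (Finset.prod_congr rfl fun i hi => by simp [T, hi])
        · intro i _ hi
          simp [T, hi]
      have hlt : ∀ k ∈ I, (insert a I).filter (· < k) = I.filter (· < k) := by
        intro k hk
        rw [Finset.filter_insert, if_neg (ha k hk).not_gt]
      have hlta : (insert a I).filter (· < a) = I := by
        rw [Finset.filter_insert, if_neg (lt_irrefl a), Finset.filter_true_of_mem ha]
      have hrest : ∏ k ∈ I, ∏ i ∈ (insert a I).filter (· < k), (F i ∩ F k).card =
          ∏ k ∈ I, ∏ i ∈ I.filter (· < k), (F i ∩ F k).card :=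
        Finset.prod_congr rfl fun k hk => by rw [hlt k hk]
      rw [Finset.prod_insert haI, Finset.prod_insert haI, hlta, hrest]
      set R := ∏ k ∈ I, ∏ i ∈ I.filter (· < k), (F i ∩ F k).card
      calc (F a).card * ∏ i ∈ I, (F i).card
          ≤ (F a).card * (J.card * R) := Nat.mul_le_mul_left _ hle
        _ = (J.card * (F a).card) * R := by ring
        _ ≤ ((J ⊼ F a).card * (J ⊻ F a).card) * R :=
            Nat.mul_le_mul_right _ (Finset.le_card_infs_mul_card_sups J (F a))
        _ ≤ ((∏ i ∈ I, (F i ∩ F a).card) * (J ⊻ F a).card) * R := by gcongr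
        _ = _ := by ring

/-- Overlapping tuples of nonempty down-sets of subsets of `V`. -/
structure OverlapDown {α : Type*} [DecidableEq α] {ℓ : ℕ} (m : Fin ℓ → Fin ℓ → ℕ)
    (V : Finset α) (F : Fin ℓ → Finset (Finset α)) : Prop where
  empty_mem : ∀ k, ∅ ∈ F k
  subset : ∀ k, ∀ A ∈ F k, A ⊆ V
  down : ∀ k, ∀ A ∈ F k, ∀ B, B ⊆ A → B ∈ F k
  overlap : ∀ i j, i ≠ j → ∀ A ∈ F i, ∀ B ∈ F j, (A ∩ B).card ≤ m i j

lemma mem_pairs {ℓ : ℕ} {p : Fin ℓ × Fin ℓ} : p ∈ pairs ℓ ↔ p.1 < p.2 := by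
  simp [pairs]

lemma prod_pairs {ℓ : ℕ} (f : Fin ℓ → Fin ℓ → ℕ) :
    ∏ p ∈ pairs ℓ, f p.1 p.2 = ∏ k, ∏ i ∈ Finset.univ.filter (· < k), f i k := by
  simp only [pairs, Finset.prod_filter]
  rw [← Finset.univ_product_univ, Finset.prod_product_right]

lemma OverlapDown.prod_card_le {α : Type*} [DecidableEq α] {ℓ : ℕ} {m : Fin ℓ → Fin ℓ → ℕ}
    {V : Finset α} {F : Fin ℓ → Finset (Finset α)} (h : OverlapDown m V F) :
    ∏ k, (F k).card ≤ 2 ^ V.card * ∏ p ∈ pairs ℓ, (F p.1 ∩ F p.2).card := by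
  obtain ⟨J, hJ, hle⟩ := exists_join_prod_card_le F h.down Finset.univ
  rw [prod_pairs fun i k => (F i ∩ F k).card]
  refine hle.trans (Nat.mul_le_mul_right _ ?_)
  rw [← Finset.card_powerset]
  refine Finset.card_le_card fun A hA => ?_
  obtain ⟨B, hB, rfl⟩ := hJ A hA
  exact Finset.mem_powerset.2 (Finset.biUnion_subset.2 fun i hi => h.subset i _ (hB i hi))

/-- There are at most `(u + k) ^ k / k!` subsets of size at most `k` of a `u`-element set. -/
lemma card_le_of_card_le {α : Type*} [DecidableEq α] (U : Finset α) (k : ℕ)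
    (G : Finset (Finset α)) (hG : ∀ A ∈ G, A ⊆ U ∧ A.card ≤ k) :
    (G.card : ℝ) ≤ (k.factorial : ℝ)⁻¹ * ((U.card : ℝ) + k) ^ k := by
  have h1 : G.card ≤ (U.card + k).choose k := by
    have hsub : G ⊆ (Finset.range (k + 1)).biUnion fun i => U.powersetCard i := by
      intro A hA
      have := hG A hA
      exact Finset.mem_biUnion.2 ⟨A.card, Finset.mem_range.2 (by omega),
        Finset.mem_powersetCard.2 ⟨this.1, rfl⟩⟩
    refine (Finset.card_le_card hsub).trans (Finset.card_biUnion_le.trans ?_)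
    rw [Nat.add_choose_eq, Finset.Nat.sum_antidiagonal_eq_sum_range_succ_mk]
    refine Finset.sum_le_sum fun i hi => ?_
    rw [Finset.card_powersetCard]
    exact Nat.le_mul_of_pos_right _ (Nat.choose_pos (Nat.sub_le _ _))
  calc (G.card : ℝ) ≤ ((U.card + k).choose k : ℝ) := by exact_mod_cast h1
    _ ≤ ((U.card + k : ℕ) : ℝ) ^ k / k.factorial := Nat.choose_le_pow_div _ _
    _ = _ := by push_cast; ring

/-- The weighted arithmetic-geometric mean inequality with natural number weights. -/
lemma prod_pow_le_prod_pow {ι : Type*} (s : Finset ι) (m : ι → ℕ) (v : ι → ℝ) (N : ℝ)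
    (hv : ∀ i ∈ s, 0 ≤ v i) (hN : ∑ i ∈ s, v i ≤ N) (hm : 0 < ∑ i ∈ s, m i) :
    ∏ i ∈ s, v i ^ m i ≤ ∏ i ∈ s, ((m i : ℝ) * N / ((∑ j ∈ s, m j : ℕ) : ℝ)) ^ m i := by
  set σ := ∑ j ∈ s, m j with hσ
  have hσ0 : (0 : ℝ) < σ := by exact_mod_cast hm
  have hσs : ∑ i ∈ s, (m i : ℝ) = σ := by rw [hσ]; push_cast; rfl
  have hz : ∀ i ∈ s, 0 ≤ v i / m i := fun i hi => div_nonneg (hv i hi) (Nat.cast_nonneg _)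
  have key := Real.geom_mean_le_arith_mean s (fun i => (m i : ℝ)) (fun i => v i / m i)
    (fun i _ => Nat.cast_nonneg _) (by rw [hσs]; exact hσ0) hz
  simp only [hσs, Real.rpow_natCast] at key
  have hsum : ∑ i ∈ s, (m i : ℝ) * (v i / m i) ≤ N := by
    refine (Finset.sum_le_sum fun i hi => ?_).trans hN
    by_cases h0 : (m i : ℝ) = 0
    · simp [h0, hv i hi]
    · rw [mul_div_cancel₀ _ h0]
  have hprod0 : 0 ≤ ∏ i ∈ s, (v i / m i) ^ m i :=
    Finset.prod_nonneg fun i hi => pow_nonneg (hz i hi) _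
  have key2 : ∏ i ∈ s, (v i / m i) ^ m i ≤ (N / σ) ^ σ := by
    have h1 : (∏ i ∈ s, (v i / m i) ^ m i) ^ ((σ : ℝ)⁻¹) ≤ N / σ :=
      key.trans (by gcongr)
    have h2 := pow_le_pow_left₀ (Real.rpow_nonneg hprod0 _) h1 σ
    rwa [Real.rpow_inv_natCast_pow hprod0 hm.ne'] at h2
  calc ∏ i ∈ s, v i ^ m i
      = ∏ i ∈ s, ((m i : ℝ) ^ m i * (v i / m i) ^ m i) := by
        refine Finset.prod_congr rfl fun i _ => ?_
        by_cases h0 : m i = 0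
        · simp [h0]
        · rw [← mul_pow, mul_div_cancel₀ _ (by exact_mod_cast h0)]
    _ = (∏ i ∈ s, (m i : ℝ) ^ m i) * ∏ i ∈ s, (v i / m i) ^ m i := Finset.prod_mul_distrib
    _ ≤ (∏ i ∈ s, (m i : ℝ) ^ m i) * (N / σ) ^ σ := by gcongr
    _ = _ := by
        nth_rewrite 2 [hσ]
        rw [← Finset.prod_pow_eq_pow_sum, ← Finset.prod_mul_distrib]
        refine Finset.prod_congr rfl fun i _ => ?_
        rw [← mul_pow, mul_div_assoc]

/-- The asymptotic count with its factor `2 ^ n` removed. -/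
def mainTerm {ℓ : ℕ} (m : Fin ℓ → Fin ℓ → ℕ) (t : ℝ) : ℝ :=
  ∏ p ∈ pairs ℓ, ((Nat.factorial (m p.1 p.2) : ℝ))⁻¹ *
    ((m p.1 p.2 : ℝ) * t / ((∑ q ∈ pairs ℓ, m q.1 q.2 : ℕ) : ℝ)) ^ (m p.1 p.2)

lemma mainTerm_eq {ℓ : ℕ} (m : Fin ℓ → Fin ℓ → ℕ) (t : ℝ) :
    mainTerm m t = t ^ (∑ q ∈ pairs ℓ, m q.1 q.2) * mainTerm m 1 := by
  unfold mainTerm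
  rw [← Finset.prod_pow_eq_pow_sum, ← Finset.prod_mul_distrib]
  refine Finset.prod_congr rfl fun p _ => ?_
  rw [mul_one, mul_div_right_comm, mul_pow]
  ring

lemma mainTerm_one_pos {ℓ : ℕ} (m : Fin ℓ → Fin ℓ → ℕ)
    (hm : 0 < ∑ q ∈ pairs ℓ, m q.1 q.2) : 0 < mainTerm m 1 := by
  refine Finset.prod_pos fun p _ => mul_pos (by positivity) ?_
  have hσ : (0 : ℝ) < ((∑ q ∈ pairs ℓ, m q.1 q.2 : ℕ) : ℝ) := by exact_mod_cast hm
  rcases Nat.eq_zero_or_pos (m p.1 p.2) with h0 | h0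
  · simp [h0]
  · positivity

lemma OverlapDown.prod_card_le_crude {α : Type*} [DecidableEq α] {ℓ : ℕ}
    {m : Fin ℓ → Fin ℓ → ℕ} {V : Finset α} {F : Fin ℓ → Finset (Finset α)}
    (h : OverlapDown m V F) (M : ℕ) (hM : ∀ p ∈ pairs ℓ, m p.1 p.2 ≤ M) :
    ((∏ k, (F k).card : ℕ) : ℝ) ≤
      2 ^ V.card * ((V.card : ℝ) + M) ^ (∑ p ∈ pairs ℓ, m p.1 p.2) := by
  have h1 : ((∏ k, (F k).card : ℕ) : ℝ) ≤
      2 ^ V.card * ∏ p ∈ pairs ℓ, ((F p.1 ∩ F p.2).card : ℝ) := by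
    exact_mod_cast h.prod_card_le
  refine h1.trans (mul_le_mul_of_nonneg_left ?_ (by positivity))
  rw [← Finset.prod_pow_eq_pow_sum]
  refine Finset.prod_le_prod (fun _ _ => Nat.cast_nonneg _) fun p hp => ?_
  have h2 := card_le_of_card_le V (m p.1 p.2) (F p.1 ∩ F p.2) fun A hA => by
    rw [Finset.mem_inter] at hA
    have := h.overlap p.1 p.2 (mem_pairs.1 hp).ne A hA.1 A hA.2
    rw [Finset.inter_self] at this
    exact ⟨h.subset _ _ hA.1, this⟩
  refine h2.trans ?_
  have hf : ((Nat.factorial (m p.1 p.2) : ℝ))⁻¹ ≤ 1 :=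
    inv_le_one_of_one_le₀ (by exact_mod_cast Nat.factorial_pos _)
  have hMp : (m p.1 p.2 : ℝ) ≤ M := by exact_mod_cast hM p hp
  calc ((Nat.factorial (m p.1 p.2) : ℝ))⁻¹ * ((V.card : ℝ) + m p.1 p.2) ^ m p.1 p.2
      ≤ 1 * ((V.card : ℝ) + M) ^ m p.1 p.2 := by gcongr
    _ = _ := one_mul _

/-- The bound for tuples in which no point lies in the support of three of the families. -/
lemma OverlapDown.prod_card_le_mainTerm {α : Type*} [DecidableEq α] {ℓ : ℕ}
    {m : Fin ℓ → Fin ℓ → ℕ} {V : Finset α} {F : Fin ℓ → Finset (Finset α)}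
    (h : OverlapDown m V F) (hm : 0 < ∑ q ∈ pairs ℓ, m q.1 q.2)
    (h3 : ∀ x i j k, i ≠ j → i ≠ k → j ≠ k → {x} ∈ F i → {x} ∈ F j → {x} ∉ F k) :
    ((∏ k, (F k).card : ℕ) : ℝ) ≤
      2 ^ V.card * mainTerm m ((V.card : ℝ) + ((∑ q ∈ pairs ℓ, m q.1 q.2 : ℕ) : ℝ)) := by
  have h1 : ((∏ k, (F k).card : ℕ) : ℝ) ≤
      2 ^ V.card * ∏ p ∈ pairs ℓ, ((F p.1 ∩ F p.2).card : ℝ) := by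
    exact_mod_cast h.prod_card_le
  refine h1.trans (mul_le_mul_of_nonneg_left ?_ (by positivity))
  let U : Fin ℓ × Fin ℓ → Finset α := fun p => V.filter fun x => {x} ∈ F p.1 ∧ {x} ∈ F p.2
  have hdisj : ((pairs ℓ : Finset _) : Set (Fin ℓ × Fin ℓ)).PairwiseDisjoint U := by
    intro p hp q hq hpq
    refine Finset.disjoint_left.2 fun x hx hx' => ?_
    simp only [U, Finset.mem_filter] at hx hx'
    have hp' := mem_pairs.1 (Finset.mem_coe.1 hp)
    have hq' := mem_pairs.1 (Finset.mem_coe.1 hq)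
    by_cases e1 : q.1 = p.1 ∨ q.1 = p.2
    · by_cases e2 : q.2 = p.1 ∨ q.2 = p.2
      · apply hpq
        rcases e1 with e1 | e1 <;> rcases e2 with e2 | e2
        · rw [e1, e2] at hq'; exact absurd hq' (lt_irrefl _)
        · exact Prod.ext e1.symm e2.symm
        · rw [e1, e2] at hq'; exact absurd hq' hp'.not_gt
        · rw [e1, e2] at hq'; exact absurd hq' (lt_irrefl _)
      · push Not at e2
        exact h3 x p.1 p.2 q.2 hp'.ne e2.1.symm e2.2.symm hx.2.1 hx.2.2 hx'.2.2
    · push Not at e1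
      exact h3 x p.1 p.2 q.1 hp'.ne e1.1.symm e1.2.symm hx.2.1 hx.2.2 hx'.2.1
  have hsumU : ∑ p ∈ pairs ℓ, (U p).card ≤ V.card := by
    rw [← Finset.card_biUnion hdisj]
    exact Finset.card_le_card (Finset.biUnion_subset.2 fun p _ => Finset.filter_subset _ _)
  have h2 : ∀ p ∈ pairs ℓ, ((F p.1 ∩ F p.2).card : ℝ) ≤
      ((Nat.factorial (m p.1 p.2) : ℝ))⁻¹ * (((U p).card : ℝ) + m p.1 p.2) ^ m p.1 p.2 := by
    intro p hp
    refine card_le_of_card_le (U p) (m p.1 p.2) _ fun A hA => ?_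
    rw [Finset.mem_inter] at hA
    have := h.overlap p.1 p.2 (mem_pairs.1 hp).ne A hA.1 A hA.2
    rw [Finset.inter_self] at this
    refine ⟨fun x hx => Finset.mem_filter.2 ⟨h.subset _ _ hA.1 hx, ?_, ?_⟩, this⟩
    · exact h.down _ _ hA.1 _ (Finset.singleton_subset_iff.2 hx)
    · exact h.down _ _ hA.2 _ (Finset.singleton_subset_iff.2 hx)
  refine (Finset.prod_le_prod (fun _ _ => Nat.cast_nonneg _) h2).trans ?_
  unfold mainTerm
  rw [Finset.prod_mul_distrib, Finset.prod_mul_distrib]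
  refine mul_le_mul_of_nonneg_left ?_ (Finset.prod_nonneg fun _ _ => by positivity)
  refine prod_pow_le_prod_pow (pairs ℓ) (fun p => m p.1 p.2)
    (fun p => ((U p).card : ℝ) + m p.1 p.2) _ (fun _ _ => by positivity) ?_ hm
  rw [Finset.sum_add_distrib]
  push_cast
  gcongr
  exact_mod_cast hsumU

lemma three_le_card_pairs_filter {ℓ : ℕ} (T : Finset (Fin ℓ)) (hT : T.card = 3) :
    3 ≤ ((pairs ℓ).filter fun p => p.1 ∈ T ∧ p.2 ∈ T).card := by
  let e := T.orderEmbOfFin hT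
  have hlt : ∀ a b : Fin 3, a < b → e a < e b := fun a b hab => e.strictMono hab
  have hmem : ∀ a, e a ∈ T := fun a => T.orderEmbOfFin_mem hT a
  have hne : ∀ a b : Fin 3, a ≠ b → e a ≠ e b := fun a b hab => e.injective.ne hab
  have hcard : ({(e 0, e 1), (e 0, e 2), (e 1, e 2)} : Finset (Fin ℓ × Fin ℓ)).card = 3 := by
    rw [Finset.card_eq_three]
    refine ⟨_, _, _, ?_, ?_, ?_, rfl⟩
    · exact fun h => hne 1 2 (by decide) (congrArg Prod.snd h)
    · exact fun h => hne 0 1 (by decide) (congrArg Prod.fst h)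
    · exact fun h => hne 0 1 (by decide) (congrArg Prod.fst h)
  rw [← hcard]
  refine Finset.card_le_card fun p hp => ?_
  simp only [Finset.mem_insert, Finset.mem_singleton] at hp
  rw [Finset.mem_filter, mem_pairs]
  rcases hp with rfl | rfl | rfl
  · exact ⟨hlt _ _ (by decide), hmem _, hmem _⟩
  · exact ⟨hlt _ _ (by decide), hmem _, hmem _⟩
  · exact ⟨hlt _ _ (by decide), hmem _, hmem _⟩

/-- The number of members of `F k` containing `x`. -/
def degAt {α : Type*} [DecidableEq α] {ℓ : ℕ} (F : Fin ℓ → Finset (Finset α)) (x : α)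
    (k : Fin ℓ) : ℕ :=
  ((F k).filter (x ∈ ·)).card

/-- The members of `F k` avoiding `x`. -/
def delAt {α : Type*} [DecidableEq α] {ℓ : ℕ} (F : Fin ℓ → Finset (Finset α)) (x : α)
    (k : Fin ℓ) : Finset (Finset α) :=
  (F k).filter (x ∉ ·)

lemma injOn_erase_of_mem {α : Type*} [DecidableEq α] (x : α) (G : Finset (Finset α)) :
    Set.InjOn (fun A : Finset α => A.erase x) (G.filter (x ∈ ·) : Finset (Finset α)) := by
  intro A hA B hB hAB
  have hA' := (Finset.mem_filter.1 (Finset.mem_coe.1 hA)).2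
  have hB' := (Finset.mem_filter.1 (Finset.mem_coe.1 hB)).2
  rw [← Finset.insert_erase hA', ← Finset.insert_erase hB']
  exact congrArg (insert x) hAB

lemma card_delAt_add_degAt {α : Type*} [DecidableEq α] {ℓ : ℕ}
    (F : Fin ℓ → Finset (Finset α)) (x : α) (k : Fin ℓ) :
    (delAt F x k).card + degAt F x k = (F k).card := by
  rw [add_comm]
  exact Finset.card_filter_add_card_filter_not _

section
variable {α : Type*} [DecidableEq α] {ℓ : ℕ} {m : Fin ℓ → Fin ℓ → ℕ} {V : Finset α}
  {F : Fin ℓ → Finset (Finset α)}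

lemma OverlapDown.degAt_le (h : OverlapDown m V F) (x : α) (k : Fin ℓ) :
    degAt F x k ≤ (delAt F x k).card := by
  refine Finset.card_le_card_of_injOn (fun A => A.erase x) ?_ (injOn_erase_of_mem x _)
  intro A hA
  have hA' := Finset.mem_filter.1 (Finset.mem_coe.1 hA)
  exact Finset.mem_coe.2 (Finset.mem_filter.2
    ⟨h.down k _ hA'.1 _ (Finset.erase_subset _ _), Finset.notMem_erase _ _⟩)

lemma OverlapDown.delAt (h : OverlapDown m V F) (x : α) :
    OverlapDown m (V.erase x) (delAt F x) where
  empty_mem k := Finset.mem_filter.2 ⟨h.empty_mem k, Finset.notMem_empty x⟩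
  subset k A hA := by
    have hA' := Finset.mem_filter.1 hA
    exact fun y hy => Finset.mem_erase.2
      ⟨fun hyx => hA'.2 (hyx ▸ hy), h.subset k A hA'.1 hy⟩
  down k A hA B hBA := by
    have hA' := Finset.mem_filter.1 hA
    exact Finset.mem_filter.2 ⟨h.down k A hA'.1 B hBA, fun hx => hA'.2 (hBA hx)⟩
  overlap i j hij A hA B hB :=
    h.overlap i j hij A (Finset.mem_filter.1 hA).1 B (Finset.mem_filter.1 hB).1

lemma OverlapDown.singleton_mem_of_degAt_pos (h : OverlapDown m V F) {x : α} {k : Fin ℓ}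
    (hk : 0 < degAt F x k) : {x} ∈ F k := by
  obtain ⟨A, hA⟩ := Finset.card_pos.1 hk
  have hA' := Finset.mem_filter.1 hA
  exact h.down k A hA'.1 _ (Finset.singleton_subset_iff.2 hA'.2)

/-- Three families whose supports share the point `x` rarely contain it simultaneously. -/
lemma OverlapDown.prod_degAt_le (h : OverlapDown m V F) (x : α) (T : Finset (Fin ℓ))
    (hT : T.card = 3) (hxT : ∀ i ∈ T, {x} ∈ F i) :
    3 ≤ ∑ p ∈ pairs ℓ, m p.1 p.2 ∧
    ((∏ k, (if k ∈ T then degAt F x k else (F k).card) : ℕ) : ℝ) * (V.card : ℝ) ^ 3 ≤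
      2 ^ V.card * ((V.card : ℝ) + ((∑ p ∈ pairs ℓ, m p.1 p.2 : ℕ) : ℝ)) ^
        (∑ p ∈ pairs ℓ, m p.1 p.2) := by
  let m' : Fin ℓ → Fin ℓ → ℕ := fun a b => if a ∈ T ∧ b ∈ T then m a b - 1 else m a b
  let L : Fin ℓ → Finset (Finset α) := fun k =>
    if k ∈ T then ((F k).filter (x ∈ ·)).image (fun A => A.erase x) else F k
  have hLF : ∀ k, ∀ A ∈ L k, A ∈ F k ∧ (k ∈ T → insert x A ∈ F k ∧ x ∉ A) := by
    intro k A hA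
    by_cases hk : k ∈ T
    · simp only [L, if_pos hk] at hA
      obtain ⟨B, hB, rfl⟩ := Finset.mem_image.1 hA
      have hB' := Finset.mem_filter.1 hB
      refine ⟨h.down k B hB'.1 _ (Finset.erase_subset _ _), fun _ => ?_⟩
      rw [Finset.insert_erase hB'.2]
      exact ⟨hB'.1, Finset.notMem_erase _ _⟩
    · simp only [L, if_neg hk] at hA
      exact ⟨hA, fun hk' => absurd hk' hk⟩
  have hm1 : ∀ a ∈ T, ∀ b ∈ T, a ≠ b → 1 ≤ m a b := by
    intro a ha b hb hab
    simpa using h.overlap a b hab _ (hxT a ha) _ (hxT b hb)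
  have hL : OverlapDown m' V L := by
    refine ⟨fun k => ?_, fun k A hA => h.subset k A (hLF k A hA).1, fun k A hA B hBA => ?_,
      fun i j hij A hA B hB => ?_⟩
    · by_cases hk : k ∈ T
      · simp only [L, if_pos hk]
        exact Finset.mem_image.2 ⟨{x}, Finset.mem_filter.2 ⟨hxT k hk, by simp⟩, by simp⟩
      · simp only [L, if_neg hk]
        exact h.empty_mem k
    · have hA' := hLF k A hA
      by_cases hk : k ∈ T
      · simp only [L, if_pos hk]
        refine Finset.mem_image.2 ⟨insert x B, Finset.mem_filter.2 ⟨?_, ?_⟩, ?_⟩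
        · exact h.down k _ (hA'.2 hk).1 _ (Finset.insert_subset_insert x hBA)
        · exact Finset.mem_insert_self _ _
        · exact Finset.erase_insert fun hx => (hA'.2 hk).2 (hBA hx)
      · simp only [L, if_neg hk]
        exact h.down k A hA'.1 B hBA
    · have hA' := hLF i A hA
      have hB' := hLF j B hB
      by_cases hT' : i ∈ T ∧ j ∈ T
      · simp only [m', if_pos hT']
        have h1 := h.overlap i j hij _ (hA'.2 hT'.1).1 _ (hB'.2 hT'.2).1
        rw [← Finset.insert_inter_distrib, Finset.card_insert_of_notMem
          (fun hx => (hA'.2 hT'.1).2 (Finset.mem_inter.1 hx).1)] at h1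
        omega
      · simp only [m', if_neg hT']
        exact h.overlap i j hij A hA'.1 B hB'.1
  have hsum : ∑ p ∈ pairs ℓ, m' p.1 p.2 + 3 ≤ ∑ p ∈ pairs ℓ, m p.1 p.2 := by
    refine (Nat.add_le_add_left (three_le_card_pairs_filter T hT) _).trans ?_
    rw [Finset.card_filter, ← Finset.sum_add_distrib]
    refine Finset.sum_le_sum fun p hp => ?_
    by_cases hpT : p.1 ∈ T ∧ p.2 ∈ T
    · have := hm1 _ hpT.1 _ hpT.2 (mem_pairs.1 hp).ne
      simp only [m', if_pos hpT]
      omega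
    · simp only [m', if_neg hpT]
      omega
  refine ⟨by omega, ?_⟩
  set σ := ∑ p ∈ pairs ℓ, m p.1 p.2 with hσ
  have hcrude := hL.prod_card_le_crude σ fun p hp => by
    have h1 : m' p.1 p.2 ≤ m p.1 p.2 := by
      simp only [m']
      split_ifs <;> omega
    exact h1.trans (Finset.single_le_sum (f := fun p => m p.1 p.2)
      (fun _ _ => Nat.zero_le _) hp)
  have hcard : ∀ k, (L k).card = if k ∈ T then degAt F x k else (F k).card := by
    intro k
    by_cases hk : k ∈ T
    · simp only [L, if_pos hk]
      exact Finset.card_image_of_injOn (injOn_erase_of_mem x _)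
    · simp only [L, if_neg hk]
  simp only [hcard] at hcrude
  have hV : (0 : ℝ) ≤ V.card := Nat.cast_nonneg _
  have hσ1 : (1 : ℝ) ≤ σ := by exact_mod_cast (by omega : 1 ≤ σ)
  calc _ ≤ (2 ^ V.card * ((V.card : ℝ) + σ) ^ (∑ p ∈ pairs ℓ, m' p.1 p.2)) *
        ((V.card : ℝ) + σ) ^ 3 := by gcongr; linarith
    _ = 2 ^ V.card * ((V.card : ℝ) + σ) ^ (∑ p ∈ pairs ℓ, m' p.1 p.2 + 3) := by
        rw [pow_add]; ring
    _ ≤ _ := by gcongr; linarith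

end

lemma one_add_pow_le_one_add (b : ℕ) {t : ℝ} (ht0 : 0 ≤ t) (ht1 : t ≤ 1) (ℓ : ℕ) (hb : b ≤ ℓ)
    (hℓ : 0 < ℓ) : (1 + t / (2 * ℓ)) ^ b ≤ 1 + t := by
  have hℓ' : (0 : ℝ) < ℓ := by exact_mod_cast hℓ
  have h0 : 0 ≤ t / (2 * ℓ) := by positivity
  have h1 : (1 + t / (2 * ℓ)) ^ ℓ ≤ Real.exp (t / 2) := by
    calc (1 + t / (2 * ℓ)) ^ ℓ ≤ Real.exp (t / (2 * ℓ)) ^ ℓ := by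
          refine pow_le_pow_left₀ (by linarith) ?_ _
          linarith [Real.add_one_le_exp (t / (2 * (ℓ : ℝ)))]
      _ = Real.exp (t / 2) := by
          rw [← Real.exp_nat_mul]
          congr 1
          field_simp
  have h2 : 1 - t / 2 ≤ Real.exp (-(t / 2)) := by
    linarith [Real.add_one_le_exp (-(t / 2))]
  have h3 : Real.exp (t / 2) * Real.exp (-(t / 2)) = 1 := by
    rw [← Real.exp_add, add_neg_cancel, Real.exp_zero]
  have h4 : Real.exp (t / 2) * (1 - t / 2) ≤ 1 :=
    (mul_le_mul_of_nonneg_left h2 (Real.exp_pos _).le).trans h3.le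
  have h5 : Real.exp (t / 2) ≤ 1 + t := by
    nlinarith [Real.exp_pos (t / 2)]
  exact (pow_le_pow_right₀ (by linarith) hb).trans (h1.trans h5)

/-- A product of factors in `[1, 2]` is at most about `2` unless two of them are not close
to `1`. -/
lemma prod_one_add_le_or {ℓ : ℕ} (hℓ : 0 < ℓ) (ρ : Fin ℓ → ℝ) (h0 : ∀ k, 0 ≤ ρ k)
    (h1 : ∀ k, ρ k ≤ 1) {n : ℕ} (hn : 1 ≤ n) :
    ∏ k, (1 + ρ k) ≤ 2 * (1 + 1 / (n : ℝ)) ∨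
      ∃ i j, i ≠ j ∧ 1 / (4 * (ℓ : ℝ)) ≤ ρ i ∧ 1 / (2 * ℓ * (n : ℝ)) ≤ ρ j := by
  by_contra hcon
  push Not at hcon
  obtain ⟨hprod, hcon⟩ := hcon
  have hn' : (1 : ℝ) ≤ n := by exact_mod_cast hn
  have hn1 : 1 / (n : ℝ) ≤ 1 := by rw [div_le_one (by linarith)]; exact hn'
  have hn0 : 0 ≤ 1 / (n : ℝ) := by positivity
  obtain ⟨i, -, hi⟩ := Finset.exists_max_image Finset.univ ρ ⟨⟨0, hℓ⟩, Finset.mem_univ _⟩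
  apply hprod.not_ge
  rcases lt_or_ge (ρ i) (1 / (4 * (ℓ : ℝ))) with hlt | hge
  · have : ∏ k, (1 + ρ k) ≤ (1 + 1 / 2 / (2 * (ℓ : ℝ))) ^ (Finset.univ : Finset (Fin ℓ)).card := by
      rw [← Finset.prod_const]
      refine Finset.prod_le_prod (fun k _ => by linarith [h0 k]) fun k hk => ?_
      have h4 : 1 / 2 / (2 * (ℓ : ℝ)) = 1 / (4 * ℓ) := by rw [div_div]; ring
      rw [h4]
      linarith [hi k hk]
    rw [Finset.card_univ, Fintype.card_fin] at this
    linarith [one_add_pow_le_one_add ℓ (t := 1 / 2) (by norm_num) (by norm_num) ℓ le_rfl hℓ]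
  · rw [← Finset.mul_prod_erase Finset.univ _ (Finset.mem_univ i)]
    have : ∏ k ∈ Finset.univ.erase i, (1 + ρ k) ≤
        (1 + 1 / (n : ℝ) / (2 * (ℓ : ℝ))) ^ ((Finset.univ : Finset (Fin ℓ)).erase i).card := by
      rw [← Finset.prod_const]
      refine Finset.prod_le_prod (fun k _ => by linarith [h0 k]) fun k hk => ?_
      have h4 : 1 / (n : ℝ) / (2 * (ℓ : ℝ)) = 1 / (2 * ℓ * n) := by rw [div_div]; ring
      rw [h4]
      linarith [hcon i k (Finset.ne_of_mem_erase hk).symm hge]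
    have h5 := this.trans (one_add_pow_le_one_add _ hn0 hn1 ℓ
      (by simp) hℓ)
    have h6 : 0 ≤ ∏ k ∈ Finset.univ.erase i, (1 + ρ k) :=
      Finset.prod_nonneg fun k _ => by linarith [h0 k]
    nlinarith [h1 i, h0 i]

lemma one_add_mul_pow_le {a y : ℝ} (ha : 0 ≤ a) (hy0 : 0 ≤ y) (hy1 : y ≤ 1) (b : ℕ) :
    (1 + a * y) ^ b ≤ 1 + (1 + a) ^ b * y := by
  have key : (1 + a * y) ^ b ≤ 1 + ((1 + a) ^ b - 1) * y := by
    induction b with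
    | zero => simp
    | succ b ih =>
      have hQ : 1 ≤ (1 + a) ^ b := one_le_pow₀ (by linarith)
      have h1 : (1 + a * y) ^ b * (1 + a * y) ≤ (1 + ((1 + a) ^ b - 1) * y) * (1 + a * y) :=
        mul_le_mul_of_nonneg_right ih (by positivity)
      rw [pow_succ, pow_succ]
      have h2 : 0 ≤ a * ((1 + a) ^ b - 1) * (y * (1 - y)) := by
        have : 0 ≤ (1 + a) ^ b - 1 := by linarith
        have : 0 ≤ 1 - y := by linarith
        positivity
      nlinarith
  nlinarith

section
variable {α : Type*} [DecidableEq α] {ℓ : ℕ} {m : Fin ℓ → Fin ℓ → ℕ} {V : Finset α}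
  {F : Fin ℓ → Finset (Finset α)}

/-- The members of `F k` all of whose points have large relative degree in `F k`. -/
def heavy (F : Fin ℓ → Finset (Finset α)) (E : ℝ) (n : ℕ) (k : Fin ℓ) : Finset (Finset α) :=
  (F k).filter fun A => ∀ x ∈ A, E * (F k).card < degAt F x k * (n : ℝ) ^ 2

lemma OverlapDown.heavy (h : OverlapDown m V F) (E : ℝ) (n : ℕ) :
    OverlapDown m V (heavy F E n) where
  empty_mem k := Finset.mem_filter.2 ⟨h.empty_mem k, by simp⟩
  subset k A hA := h.subset k A (Finset.mem_filter.1 hA).1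
  down k A hA B hBA := by
    have hA' := Finset.mem_filter.1 hA
    exact Finset.mem_filter.2 ⟨h.down k A hA'.1 B hBA, fun x hx => hA'.2 x (hBA hx)⟩
  overlap i j hij A hA B hB :=
    h.overlap i j hij A (Finset.mem_filter.1 hA).1 B (Finset.mem_filter.1 hB).1

lemma OverlapDown.card_le_heavy (h : OverlapDown m V F) {E : ℝ} (hE : 0 ≤ E)
    (hn : 1 ≤ V.card) (hnE : 2 * E ≤ V.card) (k : Fin ℓ) :
    ((F k).card : ℝ) ≤ (1 + 2 * E / V.card) * ((_root_.heavy F E V.card k).card : ℝ) := by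
  set n := V.card with hndef
  have hn' : (1 : ℝ) ≤ n := by exact_mod_cast hn
  let Lt : Finset α := V.filter fun x => degAt F x k * (n : ℝ) ^ 2 ≤ E * (F k).card
  have hsub : F k ⊆ _root_.heavy F E n k ∪ Lt.biUnion fun x => (F k).filter (x ∈ ·) := by
    intro A hA
    rw [Finset.mem_union]
    by_cases hc : ∀ x ∈ A, E * (F k).card < degAt F x k * (n : ℝ) ^ 2
    · exact Or.inl (Finset.mem_filter.2 ⟨hA, hc⟩)
    · right
      push Not at hc
      obtain ⟨x, hx, hxE⟩ := hc
      exact Finset.mem_biUnion.2 ⟨x, Finset.mem_filter.2 ⟨h.subset k A hA hx, hxE⟩,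
        Finset.mem_filter.2 ⟨hA, hx⟩⟩
  have h1 : (F k).card ≤ (_root_.heavy F E n k).card + ∑ x ∈ Lt, degAt F x k :=
    (Finset.card_le_card hsub).trans ((Finset.card_union_le _ _).trans
      (Nat.add_le_add_left Finset.card_biUnion_le _))
  have h2 : ((F k).card : ℝ) ≤ (_root_.heavy F E n k).card + ∑ x ∈ Lt, (degAt F x k : ℝ) := by
    exact_mod_cast h1
  have h3 : ∑ x ∈ Lt, (degAt F x k : ℝ) ≤ E / n * (F k).card := by
    calc ∑ x ∈ Lt, (degAt F x k : ℝ) ≤ ∑ x ∈ Lt, E * (F k).card / (n : ℝ) ^ 2 := by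
          refine Finset.sum_le_sum fun x hx => ?_
          rw [le_div_iff₀ (by positivity)]
          exact (Finset.mem_filter.1 hx).2
      _ = Lt.card * (E * (F k).card / (n : ℝ) ^ 2) := by rw [Finset.sum_const, nsmul_eq_mul]
      _ ≤ n * (E * (F k).card / (n : ℝ) ^ 2) := by
          have : (Lt.card : ℝ) ≤ n := by exact_mod_cast Finset.card_filter_le _ _
          gcongr
      _ = _ := by field_simp
  set y := E / (n : ℝ) with hy
  have hy0 : 0 ≤ y := by positivity
  have hy1 : y ≤ 1 / 2 := by rw [hy, div_le_iff₀ (by linarith)]; linarith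
  have h4 : (1 - y) * ((F k).card : ℝ) ≤ (_root_.heavy F E n k).card := by linarith
  have h5 : (1 + 2 * E / (n : ℝ)) = 1 + 2 * y := by rw [hy]; ring
  rw [h5]
  have h6 : (1 + 2 * y) * ((1 - y) * ((F k).card : ℝ)) ≤
      (1 + 2 * y) * (_root_.heavy F E n k).card := by gcongr
  have h7 : 0 ≤ (y * (1 - 2 * y)) * ((F k).card : ℝ) := by
    have : 0 ≤ 1 - 2 * y := by linarith
    positivity
  nlinarith

/-- If a tuple of down-sets has a large product, then a point in three of the supports either
can be deleted profitably or has small degree in one of any three families. -/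
lemma OverlapDown.delete_or_degAt_le (h : OverlapDown m V F) (hℓ : 0 < ℓ)
    (hm : 0 < ∑ q ∈ pairs ℓ, m q.1 q.2)
    (hbig : 2 ^ V.card * mainTerm m V.card ≤ ((∏ k, (F k).card : ℕ) : ℝ))
    (x : α) (hx : x ∈ V) (T₀ : Finset (Fin ℓ)) (hT₀ : T₀.card = 3)
    (hxT₀ : ∀ i ∈ T₀, {x} ∈ F i) :
    (2 ≤ ∑ q ∈ pairs ℓ, m q.1 q.2 ∧ ((∏ k, (F k).card : ℕ) : ℝ) ≤
      2 * (1 + 1 / (V.card : ℝ)) * ((∏ k, (_root_.delAt F x k).card : ℕ) : ℝ)) ∨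
    ∃ k ∈ T₀, (degAt F x k : ℝ) * (V.card : ℝ) ^ 2 ≤
      (32 * (ℓ : ℝ) ^ 2 * (1 + ((∑ q ∈ pairs ℓ, m q.1 q.2 : ℕ) : ℝ)) ^
        (∑ q ∈ pairs ℓ, m q.1 q.2) / mainTerm m 1) * (F k).card := by
  have h3 := (h.prod_degAt_le x T₀ hT₀ hxT₀).1
  have hκ := mainTerm_one_pos m hm
  rw [mainTerm_eq] at hbig
  set σ := ∑ q ∈ pairs ℓ, m q.1 q.2 with hσ
  set κ := mainTerm m 1
  have hn : 1 ≤ V.card := Finset.card_pos.2 ⟨x, hx⟩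
  set n := V.card with hndef
  have hn' : (1 : ℝ) ≤ n := by exact_mod_cast hn
  have hℓ' : (0 : ℝ) < ℓ := by exact_mod_cast hℓ
  have hdel : ∀ k, (0 : ℝ) < (_root_.delAt F x k).card := fun k => by
    exact_mod_cast Finset.card_pos.2 ⟨∅, (h.delAt x).empty_mem k⟩
  have hF : ∀ k, ((F k).card : ℝ) = (_root_.delAt F x k).card + degAt F x k := fun k => by
    exact_mod_cast (card_delAt_add_degAt F x k).symm
  have hle : ∀ k, (degAt F x k : ℝ) ≤ (_root_.delAt F x k).card := fun k => by
    exact_mod_cast h.degAt_le x k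
  have hFpos : ∀ k, (0 : ℝ) < (F k).card := fun k => by
    rw [hF]; have := hdel k; positivity
  let ρ : Fin ℓ → ℝ := fun k => degAt F x k / (_root_.delAt F x k).card
  let r : Fin ℓ → ℝ := fun k => degAt F x k / (F k).card
  have hr0 : ∀ k, 0 ≤ r k := fun k => by positivity
  have hrρ : ∀ k, ρ k / 2 ≤ r k := fun k => by
    change (degAt F x k : ℝ) / (_root_.delAt F x k).card / 2 ≤ degAt F x k / (F k).card
    rw [div_div]
    refine div_le_div_of_nonneg_left (Nat.cast_nonneg _) (hFpos k) ?_
    linarith [hF k, hle k]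
  rcases prod_one_add_le_or hℓ ρ (fun k => by positivity)
    (fun k => (div_le_one (hdel k)).2 (hle k)) hn with hA | ⟨i, j, hij, hi, hj⟩
  · left
    refine ⟨by omega, ?_⟩
    have : ((∏ k, (F k).card : ℕ) : ℝ) =
        (∏ k, (1 + ρ k)) * ((∏ k, (_root_.delAt F x k).card : ℕ) : ℝ) := by
      push_cast
      rw [← Finset.prod_mul_distrib]
      refine Finset.prod_congr rfl fun k _ => ?_
      rw [hF k]
      simp only [ρ]
      field_simp [(hdel k).ne']
    rw [this]
    exact mul_le_mul_of_nonneg_right hA (Nat.cast_nonneg _)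
  · right
    have hpos : ∀ k, 0 < ρ k → {x} ∈ F k := fun k hk => by
      apply h.singleton_mem_of_degAt_pos
      by_contra h0
      have : degAt F x k = 0 := by omega
      simp [ρ, this] at hk
    have hiF := hpos i (lt_of_lt_of_le (by positivity) hi)
    have hjF := hpos j (lt_of_lt_of_le (by positivity) hj)
    obtain ⟨k, hkT, hk⟩ : ∃ k ∈ T₀, k ∉ ({i, j} : Finset (Fin ℓ)) := by
      by_contra hcon
      push Not at hcon
      have h1 := Finset.card_le_card (show T₀ ⊆ {i, j} from hcon)
      have h2 := Finset.card_le_two (a := i) (b := j)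
      omega
    simp only [Finset.mem_insert, Finset.mem_singleton, not_or] at hk
    refine ⟨k, hkT, ?_⟩
    have hTcard : ({i, j, k} : Finset (Fin ℓ)).card = 3 :=
      Finset.card_eq_three.2 ⟨i, j, k, hij, fun e => hk.1 e.symm, fun e => hk.2 e.symm, rfl⟩
    have hbound := (h.prod_degAt_le x {i, j, k} hTcard (by
      intro a ha
      simp only [Finset.mem_insert, Finset.mem_singleton] at ha
      rcases ha with rfl | rfl | rfl
      · exact hiF
      · exact hjF
      · exact hxT₀ _ hkT)).2
    have hprod : ((∏ a, (if a ∈ ({i, j, k} : Finset (Fin ℓ)) then degAt F x a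
        else (F a).card) : ℕ) : ℝ) = (r i * r j * r k) * ((∏ a, (F a).card : ℕ) : ℝ) := by
      have h1 : r i * r j * r k = ∏ a, if a ∈ ({i, j, k} : Finset (Fin ℓ)) then r a else 1 := by
        rw [Finset.prod_ite_mem, Finset.univ_inter, Finset.prod_insert, Finset.prod_pair]
        · ring
        · exact fun e => hk.2 e.symm
        · simp only [Finset.mem_insert, Finset.mem_singleton, not_or]
          exact ⟨hij, fun e => hk.1 e.symm⟩
      rw [h1]
      push_cast
      rw [← Finset.prod_mul_distrib]
      refine Finset.prod_congr rfl fun a _ => ?_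
      split_ifs
      · simp only [r]
        field_simp [(hFpos a).ne']
      · rw [one_mul]
    rw [hprod, ← hσ, ← hndef] at hbound
    have hpow : ((n : ℝ) + σ) ^ σ ≤ (n : ℝ) ^ σ * (1 + σ) ^ σ := by
      rw [← mul_pow]
      refine pow_le_pow_left₀ (by positivity) ?_ _
      nlinarith [(Nat.cast_nonneg σ : (0 : ℝ) ≤ σ)]
    have hN : (0 : ℝ) < 2 ^ n * (n : ℝ) ^ σ := by positivity
    have hmain : (r i * r j * r k) * κ * (n : ℝ) ^ 3 ≤ (1 + σ) ^ σ := by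
      have h1 : (r i * r j * r k) * (2 ^ n * ((n : ℝ) ^ σ * κ)) * (n : ℝ) ^ 3 ≤
          2 ^ n * ((n : ℝ) ^ σ * (1 + σ) ^ σ) := by
        refine le_trans ?_ (hbound.trans (by gcongr))
        have := hr0 i
        have := hr0 j
        have := hr0 k
        gcongr
      have h2 : (2 ^ n * (n : ℝ) ^ σ) * ((r i * r j * r k) * κ * (n : ℝ) ^ 3) ≤
          (2 ^ n * (n : ℝ) ^ σ) * (1 + σ) ^ σ := by linarith
      exact le_of_mul_le_mul_left h2 hN
    have hri : 1 / (8 * (ℓ : ℝ)) ≤ r i := by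
      refine le_trans ?_ (hrρ i)
      calc 1 / (8 * (ℓ : ℝ)) = 1 / (4 * (ℓ : ℝ)) / 2 := by rw [div_div]; ring
        _ ≤ ρ i / 2 := by gcongr
    have hrj : 1 / (4 * ℓ * (n : ℝ)) ≤ r j := by
      refine le_trans ?_ (hrρ j)
      calc 1 / (4 * ℓ * (n : ℝ)) = 1 / (2 * ℓ * (n : ℝ)) / 2 := by rw [div_div]; ring
        _ ≤ ρ j / 2 := by gcongr
    have hrk : r k * (n : ℝ) ^ 2 * κ ≤ 32 * (ℓ : ℝ) ^ 2 * (1 + σ) ^ σ := by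
      have h1 : 1 / (8 * (ℓ : ℝ)) * (1 / (4 * ℓ * (n : ℝ))) * r k * κ * (n : ℝ) ^ 3 ≤
          (1 + σ) ^ σ := by
        refine le_trans ?_ hmain
        have := hr0 i
        have := hr0 k
        gcongr
      have h2 : 1 / (8 * (ℓ : ℝ)) * (1 / (4 * ℓ * (n : ℝ))) * r k * κ * (n : ℝ) ^ 3 =
          (r k * (n : ℝ) ^ 2 * κ) / (32 * (ℓ : ℝ) ^ 2) := by
        field_simp
        ring
      rw [h2, div_le_iff₀ (by positivity)] at h1
      linarith
    have h1 : r k * (n : ℝ) ^ 2 ≤ 32 * (ℓ : ℝ) ^ 2 * (1 + σ) ^ σ / κ := by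
      rwa [le_div_iff₀ hκ]
    calc (degAt F x k : ℝ) * (n : ℝ) ^ 2 = (r k * (n : ℝ) ^ 2) * (F k).card := by
          simp only [r]
          field_simp [(hFpos k).ne']
      _ ≤ _ := by gcongr

end

lemma two_mul_step_le {C : ℝ} (hC : 0 ≤ C) {k σ : ℕ} (hk : 1 ≤ k) (hσ : 2 ≤ σ) :
    2 * (1 + 1 / ((k + 1 : ℕ) : ℝ)) * ((1 + C / (k : ℝ)) * (2 ^ k * (k : ℝ) ^ σ)) ≤
      (1 + C / ((k + 1 : ℕ) : ℝ)) * (2 ^ (k + 1) * ((k + 1 : ℕ) : ℝ) ^ σ) := by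
  obtain ⟨s, rfl⟩ := Nat.exists_eq_add_of_le' hσ
  have hk' : (1 : ℝ) ≤ k := by exact_mod_cast hk
  push_cast
  have h1 : 2 * (1 + 1 / ((k : ℝ) + 1)) * ((1 + C / (k : ℝ)) * (2 ^ k * (k : ℝ) ^ (s + 2))) =
      2 ^ (k + 1) * ((k + C) * ((k + 2) * k / (k + 1)) * (k : ℝ) ^ s) := by
    field_simp
    ring
  have h2 : (1 + C / ((k : ℝ) + 1)) * (2 ^ (k + 1) * ((k : ℝ) + 1) ^ (s + 2)) =
      2 ^ (k + 1) * ((k + 1 + C) * (k + 1) * ((k : ℝ) + 1) ^ s) := by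
    field_simp
    ring
  rw [h1, h2]
  have h3 : ((k : ℝ) + 2) * k / (k + 1) ≤ k + 1 := by
    rw [div_le_iff₀ (by linarith)]
    nlinarith
  gcongr <;> linarith

/-- The upper bound for tuples of down-sets. -/
lemma exists_prod_card_le {ℓ : ℕ} (hℓ : 0 < ℓ) (m : Fin ℓ → Fin ℓ → ℕ)
    (hm : 0 < ∑ q ∈ pairs ℓ, m q.1 q.2) :
    ∃ C : ℝ, 0 < C ∧ ∀ n : ℕ, 1 ≤ n → ∀ (α : Type) [DecidableEq α] (V : Finset α),
      V.card = n → ∀ F : Fin ℓ → Finset (Finset α), OverlapDown m V F →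
        ((∏ k, (F k).card : ℕ) : ℝ) ≤ (1 + C / (n : ℝ)) * (2 ^ n * mainTerm m n) := by
  have hκ := mainTerm_one_pos m hm
  set κ := mainTerm m 1 with hκdef
  set σ := ∑ q ∈ pairs ℓ, m q.1 q.2 with hσ
  set E : ℝ := 32 * (ℓ : ℝ) ^ 2 * (1 + (σ : ℝ)) ^ σ / κ with hE
  have hE0 : 0 ≤ E := by positivity
  set N : ℕ := ⌈2 * E⌉₊ + 2 with hN
  set a : ℝ := 2 * E + σ with ha
  have ha0 : 0 ≤ a := by positivity
  set Q : ℝ := (1 + a) ^ (ℓ + σ) with hQ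
  have hQ0 : 0 < Q := by positivity
  have hterm : ∀ t : ℝ, mainTerm m t = t ^ σ * κ := fun t => mainTerm_eq m t
  refine ⟨Q + N * 2 ^ (N * ℓ) / κ, by positivity, ?_⟩
  set C : ℝ := Q + N * 2 ^ (N * ℓ) / κ with hC
  have hC0 : 0 ≤ C := by positivity
  intro n
  induction n with
  | zero => intro h; omega
  | succ k ih =>
    intro hn α _ V hV F hF
    obtain ⟨n, hnk⟩ : ∃ n, n = k + 1 := ⟨_, rfl⟩
    rw [← hnk] at hn hV ⊢
    have hn' : (1 : ℝ) ≤ n := by exact_mod_cast hn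
    have hP : (1 : ℝ) ≤ 2 ^ n * (n : ℝ) ^ σ :=
      one_le_mul_of_one_le_of_one_le (one_le_pow₀ (by norm_num)) (one_le_pow₀ hn')
    rcases lt_or_ge n N with hlt | hge
    · have h1 : ∏ k, (F k).card ≤ 2 ^ (N * ℓ) := by
        calc ∏ k, (F k).card ≤ ∏ _k : Fin ℓ, 2 ^ n := by
              refine Finset.prod_le_prod' fun k _ => ?_
              rw [← hV, ← Finset.card_powerset]
              exact Finset.card_le_card fun A hA => Finset.mem_powerset.2 (hF.subset k A hA)
          _ = 2 ^ (n * ℓ) := by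
              rw [Finset.prod_const, Finset.card_univ, Fintype.card_fin, ← pow_mul]
          _ ≤ 2 ^ (N * ℓ) := Nat.pow_le_pow_right (by norm_num) (Nat.mul_le_mul_right _ hlt.le)
      have h1' : ((∏ k, (F k).card : ℕ) : ℝ) ≤ 2 ^ (N * ℓ) := by exact_mod_cast h1
      have hnN : (n : ℝ) ≤ N := by exact_mod_cast hlt.le
      have h2 : 2 ^ (N * ℓ) / κ ≤ 1 + C / n := by
        have h3 : 2 ^ (N * ℓ) / κ ≤ C / n := by
          rw [le_div_iff₀ (by linarith)]
          have h4 : (2 : ℝ) ^ (N * ℓ) / κ * n ≤ 2 ^ (N * ℓ) / κ * N := by gcongr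
          have h5 : (N : ℝ) * 2 ^ (N * ℓ) / κ = 2 ^ (N * ℓ) / κ * N := by ring
          linarith
        linarith
      rw [hterm]
      calc ((∏ k, (F k).card : ℕ) : ℝ) ≤ 2 ^ (N * ℓ) := h1'
        _ = (2 ^ (N * ℓ) / κ) * (1 * κ) := by field_simp
        _ ≤ (1 + C / n) * ((2 ^ n * (n : ℝ) ^ σ) * κ) := by gcongr
        _ = _ := by ring
    · have hnE : 2 * E ≤ (n : ℝ) :=
        (Nat.le_ceil _).trans (by exact_mod_cast (by omega : ⌈2 * E⌉₊ ≤ n))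
      have hCn : 0 ≤ C / n := by positivity
      by_cases hbig : 2 ^ n * mainTerm m n ≤ ((∏ k, (F k).card : ℕ) : ℝ)
      swap
      · have hM : 0 ≤ 2 ^ n * mainTerm m n := by rw [hterm]; positivity
        have := mul_nonneg hCn hM
        linarith
      by_cases hdel : ∃ x ∈ V, 2 ≤ σ ∧ ((∏ k, (F k).card : ℕ) : ℝ) ≤
          2 * (1 + 1 / (n : ℝ)) * ((∏ k, (delAt F x k).card : ℕ) : ℝ)
      · obtain ⟨x, hx, hσ2, hle⟩ := hdel
        have hcard : (V.erase x).card = k := by rw [Finset.card_erase_of_mem hx]; omega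
        have h1 := ih (by omega) α (V.erase x) hcard (delAt F x) (hF.delAt x)
        have h2 := two_mul_step_le hC0 (k := k) (by omega) hσ2
        rw [← hnk] at h2
        rw [hterm] at h1 ⊢
        calc _ ≤ _ := hle
          _ ≤ 2 * (1 + 1 / (n : ℝ)) * ((1 + C / (k : ℝ)) * (2 ^ k * ((k : ℝ) ^ σ * κ))) := by
              gcongr
          _ = (2 * (1 + 1 / (n : ℝ)) * ((1 + C / (k : ℝ)) * (2 ^ k * (k : ℝ) ^ σ))) * κ := by
              ring
          _ ≤ _ := mul_le_mul_of_nonneg_right h2 hκ.le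
          _ = _ := by ring
      · have hnot : ∀ x i j k, i ≠ j → i ≠ k → j ≠ k → {x} ∈ heavy F E n i →
            {x} ∈ heavy F E n j → {x} ∉ heavy F E n k := by
          intro x i j l hij hil hjl hi hj hl
          have hheavy : ∀ a ∈ ({i, j, l} : Finset (Fin ℓ)), {x} ∈ heavy F E n a := by
            intro a ha
            simp only [Finset.mem_insert, Finset.mem_singleton] at ha
            rcases ha with rfl | rfl | rfl <;> assumption
          have hxV : x ∈ V :=
            hF.subset i _ (Finset.mem_filter.1 hi).1 (Finset.mem_singleton_self x)
          have hdich := hF.delete_or_degAt_le hℓ hm (by rwa [hV]) x hxV {i, j, l}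
            (Finset.card_eq_three.2 ⟨i, j, l, hij, hil, hjl, rfl⟩)
            (fun a ha => (Finset.mem_filter.1 (hheavy a ha)).1)
          rw [hV] at hdich
          rcases hdich with hA | ⟨a, haT, hle⟩
          · exact hdel ⟨x, hxV, hA⟩
          · exact ((Finset.mem_filter.1 (hheavy a haT)).2 x
              (Finset.mem_singleton_self x)).not_ge hle
        have h1 := (hF.heavy E n).prod_card_le_mainTerm hm hnot
        rw [← hσ, hterm, hV] at h1
        rw [hterm]
        have h2 : ((∏ k, (F k).card : ℕ) : ℝ) ≤
            (1 + 2 * E / n) ^ ℓ * ((∏ k, (heavy F E n k).card : ℕ) : ℝ) := by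
          push_cast
          have h3 : (1 + 2 * E / (n : ℝ)) ^ ℓ = ∏ _k : Fin ℓ, (1 + 2 * E / (n : ℝ)) := by
            rw [Finset.prod_const, Finset.card_univ, Fintype.card_fin]
          rw [h3, ← Finset.prod_mul_distrib]
          refine Finset.prod_le_prod (fun _ _ => Nat.cast_nonneg _) fun k _ => ?_
          have h4 := hF.card_le_heavy hE0 (by rwa [hV]) (by rwa [hV]) k
          rwa [hV] at h4
        have hy0 : 0 ≤ 1 / (n : ℝ) := by positivity
        have hy1 : 1 / (n : ℝ) ≤ 1 := (div_le_one (by linarith)).2 hn'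
        have h4 : (1 + 2 * E / (n : ℝ)) ^ ℓ * (1 + σ / (n : ℝ)) ^ σ ≤ 1 + C / n := by
          calc (1 + 2 * E / (n : ℝ)) ^ ℓ * (1 + σ / (n : ℝ)) ^ σ
              ≤ (1 + a * (1 / n)) ^ ℓ * (1 + a * (1 / n)) ^ σ := by
                have hσ0 : (0 : ℝ) ≤ σ := Nat.cast_nonneg _
                have e1 : 2 * E / (n : ℝ) ≤ a * (1 / n) := by
                  rw [mul_one_div]; gcongr; linarith
                have e2 : σ / (n : ℝ) ≤ a * (1 / n) := by
                  rw [mul_one_div]; gcongr; linarith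
                gcongr
            _ = (1 + a * (1 / n)) ^ (ℓ + σ) := (pow_add _ _ _).symm
            _ ≤ 1 + Q * (1 / n) := one_add_mul_pow_le ha0 hy0 hy1 _
            _ ≤ 1 + C / n := by
                rw [mul_one_div]
                have : Q ≤ C := by
                  rw [hC]
                  have : 0 ≤ (N : ℝ) * 2 ^ (N * ℓ) / κ := by positivity
                  linarith
                gcongr
        have h5 : ((n : ℝ) + σ) ^ σ = (n : ℝ) ^ σ * (1 + σ / (n : ℝ)) ^ σ := by
          rw [← mul_pow]
          congr 1
          field_simp
        calc _ ≤ _ := h2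
          _ ≤ (1 + 2 * E / (n : ℝ)) ^ ℓ *
              (2 ^ n * (((n : ℝ) + σ) ^ σ * κ)) := by gcongr
          _ = ((1 + 2 * E / (n : ℝ)) ^ ℓ * (1 + σ / (n : ℝ)) ^ σ) *
              (2 ^ n * ((n : ℝ) ^ σ * κ)) := by rw [h5]; ring
          _ ≤ _ := mul_le_mul_of_nonneg_right h4 (by positivity)

lemma finite_products {n ℓ : ℕ} (m : Fin ℓ → Fin ℓ → ℕ) :
    {P : ℕ | ∃ F : Fin ℓ → Finset (Finset (Fin n)), Overlap m F ∧ P = ∏ k, (F k).card}.Finite := by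
  refine (Set.finite_range fun F : Fin ℓ → Finset (Finset (Fin n)) => ∏ k, (F k).card).subset ?_
  rintro P ⟨F, -, rfl⟩
  exact ⟨F, rfl⟩

lemma exists_overlap_eq_sStar (n ℓ : ℕ) (m : Fin ℓ → Fin ℓ → ℕ) :
    ∃ F : Fin ℓ → Finset (Finset (Fin n)), Overlap m F ∧ sStar n ℓ m = ∏ k, (F k).card := by
  have hne : {P : ℕ | ∃ F : Fin ℓ → Finset (Finset (Fin n)),
      Overlap m F ∧ P = ∏ k, (F k).card}.Nonempty :=
    ⟨_, fun _ => ∅, fun _ _ _ A hA => absurd hA (Finset.notMem_empty A), rfl⟩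
  exact Nat.sSup_mem hne (finite_products m).bddAbove

lemma prod_card_le_sStar {n ℓ : ℕ} {m : Fin ℓ → Fin ℓ → ℕ}
    {F : Fin ℓ → Finset (Finset (Fin n))} (hF : Overlap m F) :
    ∏ k, (F k).card ≤ sStar n ℓ m :=
  le_csSup (finite_products m).bddAbove ⟨F, hF, rfl⟩

/-- Passing to the generated down-sets, an overlapping tuple may be assumed to consist of
nonempty down-sets. -/
lemma Overlap.exists_overlapDown {n ℓ : ℕ} {m : Fin ℓ → Fin ℓ → ℕ}
    {F : Fin ℓ → Finset (Finset (Fin n))} (hF : Overlap m F) (hne : ∀ k, (F k).Nonempty) :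
    ∃ G : Fin ℓ → Finset (Finset (Fin n)), OverlapDown m Finset.univ G ∧
      ∏ k, (F k).card ≤ ∏ k, (G k).card := by
  let G : Fin ℓ → Finset (Finset (Fin n)) := fun k =>
    Finset.univ.filter fun A => ∃ B ∈ F k, A ⊆ B
  have hG : ∀ k A, A ∈ G k ↔ ∃ B ∈ F k, A ⊆ B := fun k A => by simp [G]
  refine ⟨G, ⟨fun k => ?_, fun k A _ => Finset.subset_univ A, fun k A hA B hBA => ?_,
    fun i j hij A hA B hB => ?_⟩, ?_⟩
  · obtain ⟨B, hB⟩ := hne k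
    exact (hG k _).2 ⟨B, hB, Finset.empty_subset _⟩
  · obtain ⟨D, hD, hAD⟩ := (hG k A).1 hA
    exact (hG k B).2 ⟨D, hD, hBA.trans hAD⟩
  · obtain ⟨A', hA', hAA'⟩ := (hG i A).1 hA
    obtain ⟨B', hB', hBB'⟩ := (hG j B).1 hB
    exact (Finset.card_le_card (Finset.inter_subset_inter hAA' hBB')).trans
      (hF i j hij A' hA' B' hB')
  · refine Finset.prod_le_prod' fun k _ => Finset.card_le_card fun A hA => ?_
    exact (hG k A).2 ⟨A, hA, subset_rfl⟩

lemma exists_sStar_le {ℓ : ℕ} (hℓ : 0 < ℓ) (m : Fin ℓ → Fin ℓ → ℕ)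
    (hm : 0 < ∑ q ∈ pairs ℓ, m q.1 q.2) :
    ∃ C : ℝ, 0 < C ∧ ∀ n : ℕ, 1 ≤ n →
      (sStar n ℓ m : ℝ) ≤ (1 + C / (n : ℝ)) * (2 ^ n * mainTerm m n) := by
  obtain ⟨C, hC, hub⟩ := exists_prod_card_le hℓ m hm
  refine ⟨C, hC, fun n hn => ?_⟩
  obtain ⟨F, hF, hs⟩ := exists_overlap_eq_sStar n ℓ m
  rw [hs]
  by_cases hne : ∀ k, (F k).Nonempty
  · obtain ⟨G, hG, hle⟩ := hF.exists_overlapDown hne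
    refine le_trans (by exact_mod_cast hle) (hub n hn (Fin n) Finset.univ (by simp) G hG)
  · push Not at hne
    obtain ⟨k, hk⟩ := hne
    rw [Finset.prod_eq_zero (Finset.mem_univ k) (by rw [hk, Finset.card_empty]), mainTerm_eq]
    have := mainTerm_one_pos m hm
    push_cast
    positivity

/-- Colour the points of `[n]` by pairs; on points coloured `(a, b)` the first family is
unrestricted, the `b`-th has at most `m a b` elements, and the others are empty. -/
lemma two_pow_mul_prod_choose_le_sStar {n ℓ : ℕ} {m : Fin ℓ → Fin ℓ → ℕ}
    (hsym : ∀ k1 k2, m k1 k2 = m k2 k1) (c : Fin n → Fin ℓ × Fin ℓ) (hc : ∀ x, c x ∈ pairs ℓ) :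
    2 ^ n * ∏ p ∈ pairs ℓ, ((Finset.univ.filter (c · = p)).card).choose (m p.1 p.2) ≤
      sStar n ℓ m := by
  have hlt : ∀ x, (c x).1 < (c x).2 := fun x => mem_pairs.1 (hc x)
  let F : Fin ℓ → Finset (Finset (Fin n)) := fun k => Finset.univ.filter fun A =>
    (∀ x ∈ A, k = (c x).1 ∨ k = (c x).2) ∧
      ∀ p ∈ pairs ℓ, p.2 = k → (A.filter (c · = p)).card ≤ m p.1 p.2
  have hF : ∀ k A, A ∈ F k ↔ (∀ x ∈ A, k = (c x).1 ∨ k = (c x).2) ∧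
      ∀ p ∈ pairs ℓ, p.2 = k → (A.filter (c · = p)).card ≤ m p.1 p.2 := fun k A => by simp [F]
  have hlt_overlap : ∀ i j, i < j → ∀ A ∈ F i, ∀ B ∈ F j, (A ∩ B).card ≤ m i j := by
    intro i j hij A hA B hB
    rw [hF] at hA hB
    refine (Finset.card_le_card fun x hx => ?_).trans (hB.2 (i, j) (mem_pairs.2 hij) rfl)
    rw [Finset.mem_inter] at hx
    refine Finset.mem_filter.2 ⟨hx.2, ?_⟩
    have h1 := hA.1 x hx.1
    have h2 := hB.1 x hx.2
    have h3 := hlt x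
    rw [Fin.lt_def] at h3 hij
    have key : i = (c x).1 ∧ j = (c x).2 := by
      rw [Fin.ext_iff, Fin.ext_iff] at h1 h2
      constructor <;> (apply Fin.ext; omega)
    exact Prod.ext key.1.symm key.2.symm
  have hoverlap : Overlap m F := by
    intro i j hij A hA B hB
    rcases lt_or_gt_of_ne hij with h | h
    · exact hlt_overlap i j h A hA B hB
    · rw [Finset.inter_comm, hsym]
      exact hlt_overlap j i h B hB A hA
  refine le_trans ?_ (prod_card_le_sStar hoverlap)
  let W : Fin ℓ × Fin ℓ → Finset (Finset (Fin n)) := fun p =>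
    if p ∈ pairs ℓ then (Finset.univ.filter (c · = p)).powersetCard (m p.1 p.2) else {∅}
  have hW : ∀ p ∈ pairs ℓ, ∀ Y ∈ W p, (∀ x ∈ Y, c x = p) ∧ Y.card = m p.1 p.2 := by
    intro p hp Y hY
    simp only [W, if_pos hp, Finset.mem_powersetCard] at hY
    exact ⟨fun x hx => (Finset.mem_filter.1 (hY.1 hx)).2, hY.2⟩
  have hcardW : ((Finset.univ : Finset (Finset (Fin n))) ×ˢ Fintype.piFinset W).card =
      2 ^ n * ∏ p ∈ pairs ℓ, ((Finset.univ.filter (c · = p)).card).choose (m p.1 p.2) := by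
    rw [Finset.card_product, Finset.card_univ, Fintype.card_finset, Fintype.card_fin,
      Fintype.card_piFinset, ← Finset.prod_subset (Finset.subset_univ (pairs ℓ))]
    · congr 1
      refine Finset.prod_congr rfl fun p hp => ?_
      simp only [W, if_pos hp, Finset.card_powersetCard]
    · intro p _ hp
      simp only [W, if_neg hp, Finset.card_singleton]
  rw [← hcardW, ← Fintype.card_piFinset]
  let Φ : Finset (Fin n) × (Fin ℓ × Fin ℓ → Finset (Fin n)) → Fin ℓ → Finset (Fin n) :=
    fun z k => Finset.univ.filter fun x =>
      (k = (c x).1 ∧ x ∈ z.1) ∨ (k = (c x).2 ∧ x ∈ z.2 (c x))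
  have hΦ : ∀ z k x, x ∈ Φ z k ↔
      (k = (c x).1 ∧ x ∈ z.1) ∨ (k = (c x).2 ∧ x ∈ z.2 (c x)) := fun z k x => by simp [Φ]
  have hΦ1 : ∀ z x, x ∈ Φ z (c x).1 ↔ x ∈ z.1 := fun z x => by
    rw [hΦ]
    simp [(hlt x).ne]
  have hΦ2 : ∀ z x, x ∈ Φ z (c x).2 ↔ x ∈ z.2 (c x) := fun z x => by
    rw [hΦ]
    simp [(hlt x).ne']
  refine Finset.card_le_card_of_injOn Φ ?_ ?_
  · intro z hz
    have hz2 := Fintype.mem_piFinset.1 (Finset.mem_product.1 (Finset.mem_coe.1 hz)).2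
    refine Finset.mem_coe.2 (Fintype.mem_piFinset.2 fun k => (hF k _).2 ⟨fun x hx => ?_, ?_⟩)
    · rcases (hΦ z k x).1 hx with h | h
      · exact Or.inl h.1
      · exact Or.inr h.1
    · rintro p hp rfl
      rw [← (hW p hp _ (hz2 p)).2]
      refine Finset.card_le_card fun x hx => ?_
      obtain ⟨hx, rfl⟩ := Finset.mem_filter.1 hx
      exact (hΦ2 z x).1 hx
  · rintro ⟨X, Y⟩ hz ⟨X', Y'⟩ hz' heq
    have hz2 := Fintype.mem_piFinset.1 (Finset.mem_product.1 (Finset.mem_coe.1 hz)).2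
    have hz2' := Fintype.mem_piFinset.1 (Finset.mem_product.1 (Finset.mem_coe.1 hz')).2
    have hX : X = X' := by
      ext x
      rw [← hΦ1 (X, Y) x, heq, hΦ1]
    have hY : Y = Y' := by
      funext p
      by_cases hp : p ∈ pairs ℓ
      · ext x
        have hYY : ∀ x, c x = p → (x ∈ Y p ↔ x ∈ Y' p) := by
          rintro x rfl
          rw [← hΦ2 (X, Y) x, heq, hΦ2]
        constructor
        · intro hx
          exact (hYY x ((hW p hp _ (hz2 p)).1 x hx)).1 hx
        · intro hx
          exact (hYY x ((hW p hp _ (hz2' p)).1 x hx)).2 hx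
      · have h1 := hz2 p
        have h2 := hz2' p
        simp only [W, if_neg hp, Finset.mem_singleton] at h1 h2
        exact h1.trans h2.symm
    rw [hX, hY]

/-- A colouring of `[n]` whose colour classes have sizes nearly proportional to given
weights. -/
lemma exists_colouring {ι : Type*} (s : Finset ι) (w : ι → ℕ) (hw : 0 < ∑ i ∈ s, w i) (n : ℕ) :
    ∃ c : Fin n → ι, (∀ x, c x ∈ s) ∧
      ∀ i ∈ s, w i * (n / ∑ j ∈ s, w j) ≤ (Finset.univ.filter (c · = i)).card := by
  set σ := ∑ j ∈ s, w j with hσ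
  have hcard : Fintype.card (Σ i : s, Fin (w i)) = σ := by
    rw [Fintype.card_sigma, hσ]
    simp only [Fintype.card_fin]
    exact Finset.sum_coe_sort s w
  let e : (Σ i : s, Fin (w i)) ≃ Fin σ := Fintype.equivFinOfCardEq hcard
  refine ⟨fun x => (e.symm ⟨x % σ, Nat.mod_lt _ hw⟩).1, fun x => Subtype.prop _, fun i hi => ?_⟩
  have h1 : w i * (n / σ) = (Finset.univ : Finset (Fin (w i) × Fin (n / σ))).card := by simp
  rw [h1]
  have hlt : ∀ (a : Fin (w i)) (t : Fin (n / σ)), (e ⟨⟨i, hi⟩, a⟩ : ℕ) + σ * t < n := by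
    intro a t
    have h2 := (e ⟨⟨i, hi⟩, a⟩).2
    have h3 : σ * (t + 1) ≤ σ * (n / σ) := Nat.mul_le_mul_left _ t.2
    have h4 := Nat.mul_div_le n σ
    rw [mul_add, mul_one] at h3
    omega
  have hmod : ∀ (a : Fin (w i)) (t : Fin (n / σ)),
      ((e ⟨⟨i, hi⟩, a⟩ : ℕ) + σ * t) % σ = e ⟨⟨i, hi⟩, a⟩ := by
    intro a t
    rw [Nat.add_mul_mod_self_left, Nat.mod_eq_of_lt (e ⟨⟨i, hi⟩, a⟩).2]
  refine Finset.card_le_card_of_injOn (fun z => ⟨(e ⟨⟨i, hi⟩, z.1⟩ : ℕ) + σ * z.2, hlt _ _⟩) ?_ ?_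
  · intro z _
    simp [hmod]
  · rintro ⟨a, t⟩ _ ⟨b, u⟩ _ heq
    have heq' : (e ⟨⟨i, hi⟩, a⟩ : ℕ) + σ * t = (e ⟨⟨i, hi⟩, b⟩ : ℕ) + σ * u :=
      congrArg Fin.val heq
    have h2 : (e ⟨⟨i, hi⟩, a⟩ : ℕ) = e ⟨⟨i, hi⟩, b⟩ := by rw [← hmod a t, heq', hmod]
    have h3 : a = b := by
      have := e.injective (Fin.ext h2)
      simpa using this
    have h4 : (t : ℕ) = u := by
      have : σ * (t : ℕ) = σ * u := by omega
      exact Nat.eq_of_mul_eq_mul_left hw this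
    rw [h3, Fin.ext h4]

lemma le_choose_of_le {u k : ℕ} {t : ℝ} (ht : 0 ≤ t) (hu : t + k ≤ u) :
    (k.factorial : ℝ)⁻¹ * t ^ k ≤ (u.choose k : ℝ) := by
  have hku : k ≤ u := by
    have : (k : ℝ) ≤ u := by linarith
    exact_mod_cast this
  have h1 : (u - k) ^ k ≤ k.factorial * u.choose k := by
    rw [← Nat.descFactorial_eq_factorial_mul_choose]
    exact (Nat.pow_le_pow_left (by omega) _).trans (Nat.pow_sub_le_descFactorial u k)
  have h2 : ((u : ℝ) - k) ^ k ≤ k.factorial * u.choose k := by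
    rw [← Nat.cast_sub hku]
    exact_mod_cast h1
  have h3 : t ^ k ≤ ((u : ℝ) - k) ^ k := pow_le_pow_left₀ ht (by linarith) _
  rw [inv_mul_le_iff₀ (by exact_mod_cast Nat.factorial_pos k)]
  linarith

lemma le_sStar {ℓ : ℕ} {m : Fin ℓ → Fin ℓ → ℕ} (hsym : ∀ k1 k2, m k1 k2 = m k2 k1)
    (hm : 0 < ∑ q ∈ pairs ℓ, m q.1 q.2) {C : ℝ}
    (hC : 2 * ((∑ q ∈ pairs ℓ, m q.1 q.2 : ℕ) : ℝ) ^ 2 ≤ C) {n : ℕ} (hn : 1 ≤ n) :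
    (1 - C / (n : ℝ)) * (2 ^ n * mainTerm m n) ≤ (sStar n ℓ m : ℝ) := by
  have hκ := mainTerm_one_pos m hm
  have hn' : (1 : ℝ) ≤ n := by exact_mod_cast hn
  set σ := ∑ q ∈ pairs ℓ, m q.1 q.2 with hσ
  have hσ1 : (1 : ℝ) ≤ σ := by exact_mod_cast hm
  have hterm : mainTerm m n = (n : ℝ) ^ σ * mainTerm m 1 := mainTerm_eq m n
  have hM : 0 ≤ 2 ^ n * mainTerm m n := by rw [hterm]; positivity
  rcases le_or_gt (n : ℝ) (2 * σ) with hsmall | hlarge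
  · have h1 : 1 - C / (n : ℝ) ≤ 0 := by
      rw [sub_nonpos, one_le_div (by linarith)]
      nlinarith
    exact (mul_nonpos_of_nonpos_of_nonneg h1 hM).trans (Nat.cast_nonneg _)
  · obtain ⟨c, hc, hcard⟩ := exists_colouring (pairs ℓ) (fun p => m p.1 p.2) hm n
    have h1 := two_pow_mul_prod_choose_le_sStar hsym c hc
    have h1' : (2 ^ n * ∏ p ∈ pairs ℓ,
        (((Finset.univ.filter (c · = p)).card).choose (m p.1 p.2) : ℝ)) ≤ sStar n ℓ m := by
      exact_mod_cast h1
    refine le_trans ?_ h1'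
    have h2 : mainTerm m ((n : ℝ) - 2 * σ) ≤ ∏ p ∈ pairs ℓ,
        (((Finset.univ.filter (c · = p)).card).choose (m p.1 p.2) : ℝ) := by
      unfold mainTerm
      have hpos : 0 ≤ (n : ℝ) - 2 * σ := by linarith
      refine Finset.prod_le_prod (fun p _ => by positivity) fun p hp => ?_
      refine le_choose_of_le (by positivity) ?_
      rw [← hσ]
      have h3 : (m p.1 p.2 : ℝ) * ((n / σ : ℕ) : ℝ) ≤ (Finset.univ.filter (c · = p)).card := by
        have h3' : m p.1 p.2 * (n / σ) ≤ (Finset.univ.filter (c · = p)).card := by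
          convert hcard p hp
        exact_mod_cast h3'
      refine le_trans ?_ h3
      have h4 : (n : ℝ) / σ - 1 ≤ ((n / σ : ℕ) : ℝ) := by
        have h5 : n < σ * (n / σ + 1) := by
          have := Nat.lt_mul_div_succ n hm
          exact this
        have h6 : (n : ℝ) ≤ σ * (((n / σ : ℕ) : ℝ) + 1) := by exact_mod_cast h5.le
        rw [sub_le_iff_le_add, div_le_iff₀ (by linarith)]
        linarith
      calc (m p.1 p.2 : ℝ) * ((n : ℝ) - 2 * σ) / σ + m p.1 p.2
          = (m p.1 p.2 : ℝ) * ((n : ℝ) / σ - 1) := by field_simp; ring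
        _ ≤ _ := by gcongr
    have h7 : 1 - C / (n : ℝ) ≤ (1 - 2 * σ / n) ^ σ := by
      have h8 : 2 * (σ : ℝ) / n ≤ 1 := (div_le_one (by linarith)).2 hlarge.le
      have h9 := one_add_mul_le_pow (a := -(2 * (σ : ℝ) / n)) (by linarith) σ
      have h10 : (σ : ℝ) * (2 * σ / n) ≤ C / n := by
        rw [← mul_div_assoc]
        gcongr
        nlinarith
      calc 1 - C / (n : ℝ) ≤ 1 + σ * (-(2 * (σ : ℝ) / n)) := by linarith
        _ ≤ _ := by rw [sub_eq_add_neg]; exact h9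
    calc (1 - C / (n : ℝ)) * (2 ^ n * mainTerm m n)
        ≤ (1 - 2 * σ / n) ^ σ * (2 ^ n * mainTerm m n) := mul_le_mul_of_nonneg_right h7 hM
      _ = 2 ^ n * mainTerm m ((n : ℝ) - 2 * σ) := by
          rw [hterm, mainTerm_eq m ((n : ℝ) - 2 * σ), ← hσ]
          have : (n : ℝ) - 2 * σ = (1 - 2 * σ / n) * n := by field_simp
          rw [this, mul_pow]
          ring
      _ ≤ _ := by gcongr

/-- For fixed `ℓ ≥ 2` and a symmetric not-all-zero vector `𝐦`,
with `σ = Σ_S 𝐦_S` and `P(n) = 2^n · Π_S (1/𝐦_S!)·(𝐦_S·n/σ)^{𝐦_S}`, there is `C > 0`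
with `(1 − C/n)·P(n) ≤ s*(n,ℓ,𝐦) ≤ (1 + C/n)·P(n)` for all `n ≥ 1`. -/
theorem sStar_asymptotics_linear (ℓ : ℕ) (hℓ : 2 ≤ ℓ) (m : Fin ℓ → Fin ℓ → ℕ)
    (hsym : ∀ k1 k2, m k1 k2 = m k2 k1)
    (hnz : ∃ k1 k2 : Fin ℓ, k1 ≠ k2 ∧ 0 < m k1 k2) :
    ∃ C : ℝ, 0 < C ∧ ∀ n : ℕ, 1 ≤ n →
      (1 - C / (n : ℝ)) *
          (2 ^ n * ∏ p ∈ pairs ℓ,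
            ((Nat.factorial (m p.1 p.2) : ℝ))⁻¹ *
              ((m p.1 p.2 : ℝ) * n / ((∑ q ∈ pairs ℓ, m q.1 q.2 : ℕ) : ℝ)) ^ (m p.1 p.2))
        ≤ (sStar n ℓ m : ℝ) ∧
      (sStar n ℓ m : ℝ) ≤
        (1 + C / (n : ℝ)) *
          (2 ^ n * ∏ p ∈ pairs ℓ,
            ((Nat.factorial (m p.1 p.2) : ℝ))⁻¹ *
              ((m p.1 p.2 : ℝ) * n / ((∑ q ∈ pairs ℓ, m q.1 q.2 : ℕ) : ℝ)) ^ (m p.1 p.2)) := by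
  have hm : 0 < ∑ q ∈ pairs ℓ, m q.1 q.2 := by
    obtain ⟨k1, k2, hne, hpos⟩ := hnz
    refine Finset.sum_pos' (fun _ _ => Nat.zero_le _) ?_
    rcases lt_or_gt_of_ne hne with h | h
    · exact ⟨(k1, k2), mem_pairs.2 h, hpos⟩
    · exact ⟨(k2, k1), mem_pairs.2 h, hsym k1 k2 ▸ hpos⟩
  obtain ⟨C, hC, hub⟩ := exists_sStar_le (by omega) m hm
  refine ⟨C + 2 * ((∑ q ∈ pairs ℓ, m q.1 q.2 : ℕ) : ℝ) ^ 2, by positivity, fun n hn => ⟨?_, ?_⟩⟩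
  · exact le_sStar hsym hm (by linarith) hn
  · refine (hub n hn).trans ?_
    have hM : 0 ≤ 2 ^ n * mainTerm m (n : ℝ) := by
      rw [mainTerm_eq]
      have := mainTerm_one_pos m hm
      positivity
    refine mul_le_mul_of_nonneg_right ?_ hM
    gcongr
    linarith [sq_nonneg ((∑ q ∈ pairs ℓ, m q.1 q.2 : ℕ) : ℝ)]

end
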